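/- Let p(x_1,x_2,x_3) = 3x_1x_2 + x_1x_3 + x_2x_3. Then: (a) p is a 2-homogeneous multiaffine polynomial that is log-concave over ℝ³_{≥0}; and (b) for every set function f : 2^{[3]} → ℝ_{≥0} with f({1,2}) = 3, f({1,3}) = 1, and f({2,3}) = 1 (i.e., the generating polynomial of f^{(2)} equals p), f is not simultaneously monotone, submodular, and nonnegative on nonempty sets, and f is not a 2-coverage function. -/

import Mathlib

open MvPolynomial

/-- The directional derivative `D_a p = ∑ i, a i * ∂_{z i} p`. -/
noncomputable def dirDeriv {n : ℕ} (a : Fin n → ℝ) (p : MvPolynomial (Fin n) ℝ) :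
    MvPolynomial (Fin n) ℝ :=
  ∑ i : Fin n, MvPolynomial.C (a i) * MvPolynomial.pderiv i p

/-- Iterated directional derivatives `D_{a₁} ⋯ D_{a_k} p`. -/
noncomputable def dirDerivs {n : ℕ} (as : List (Fin n → ℝ)) (p : MvPolynomial (Fin n) ℝ) :
    MvPolynomial (Fin n) ℝ :=
  as.foldr dirDeriv p

/-- `p` is nonnegative on the nonnegative orthant and `log p` is concave there
(`x ^ t` denotes the real power `rpow`). -/
def LogConcaveOn {n : ℕ} (p : MvPolynomial (Fin n) ℝ) : Prop :=
  (∀ x : Fin n → ℝ, (∀ i, 0 ≤ x i) → 0 ≤ MvPolynomial.eval x p) ∧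
    ∀ x y : Fin n → ℝ, (∀ i, 0 ≤ x i) → (∀ i, 0 ≤ y i) → ∀ t : ℝ, 0 ≤ t → t ≤ 1 →
      MvPolynomial.eval x p ^ t * MvPolynomial.eval y p ^ (1 - t) ≤
        MvPolynomial.eval (fun i => t * x i + (1 - t) * y i) p

/-- `p` is completely log-concave. -/
def CompletelyLogConcave {n : ℕ} (p : MvPolynomial (Fin n) ℝ) : Prop :=
  ∀ as : List (Fin n → ℝ), (∀ a ∈ as, ∀ i, 0 ≤ a i) → LogConcaveOn (dirDerivs as p)

/-- Generating polynomial of a set function. -/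
noncomputable def genPoly {n : ℕ} (f : Finset (Fin n) → ℝ) : MvPolynomial (Fin n) ℝ :=
  ∑ S : Finset (Fin n), MvPolynomial.C (f S) * ∏ i ∈ S, MvPolynomial.X i

/-- Generating polynomial of a set function restricted to subsets of `V`. -/
noncomputable def genPolyOn {n : ℕ} (V : Finset (Fin n)) (f : Finset (Fin n) → ℝ) :
    MvPolynomial (Fin n) ℝ :=
  ∑ S ∈ V.powerset, MvPolynomial.C (f S) * ∏ i ∈ S, MvPolynomial.X i

/-- The `d`-homogeneous restriction `f^{(d)}` of a set function. -/
def homRestrict {n : ℕ} (f : Finset (Fin n) → ℝ) (d : ℕ) : Finset (Fin n) → ℝ :=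
  fun S => if S.card = d then f S else 0

/-- `g` is a coverage function on subsets of `V`. -/
def IsCoverageOn {n : ℕ} (V : Finset (Fin n)) (g : Finset (Fin n) → ℝ) : Prop :=
  ∃ (m : ℕ) (w : Fin m → ℝ) (A : Fin n → Finset (Fin m)),
    (∀ u, 0 ≤ w u) ∧ ∀ T ⊆ V, g T = ∑ u ∈ T.biUnion A, w u

/-- `ℓ` is a (nonnegative) linear set function on subsets of `V`. -/
def IsLinearOn {n : ℕ} (V : Finset (Fin n)) (ℓ : Finset (Fin n) → ℝ) : Prop :=
  (∀ i ∈ V, 0 ≤ ℓ {i}) ∧ ∀ T ⊆ V, ℓ T = ∑ i ∈ T, ℓ {i}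

/-- `p` cannot be written as a sum of two nonzero polynomials in disjoint sets of variables. -/
def Indecomposable {n : ℕ} (p : MvPolynomial (Fin n) ℝ) : Prop :=
  ¬ ∃ q r : MvPolynomial (Fin n) ℝ, q ≠ 0 ∧ r ≠ 0 ∧ Disjoint q.vars r.vars ∧ p = q + r

/-- `f` is 2-coverage with respect to `d`. -/
def TwoCoverageWrt {n : ℕ} (f : Finset (Fin n) → ℝ) (d : ℕ) : Prop :=
  (∀ τ : Finset (Fin n), τ.card ≤ d - 2 →
      Indecomposable (genPolyOn (Finset.univ \ τ) fun S => homRestrict f d (τ ∪ S))) ∧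
  (∀ τ : Finset (Fin n), τ.card = d - 2 →
      ∃ V : Finset (Fin n), V ⊆ Finset.univ \ τ ∧
        ∃ g ℓ : Finset (Fin n) → ℝ,
          IsCoverageOn V g ∧ IsLinearOn V ℓ ∧ (∀ i ∈ V, ℓ {i} ≤ g {i}) ∧
          ∀ T ⊆ Finset.univ \ τ, T.card = 2 →
            f (τ ∪ T) = if T ⊆ V then g T - ℓ T / 2 else 0)

/-- `f` is strongly 2-coverage. -/
def StronglyTwoCoverage {n : ℕ} (f : Finset (Fin n) → ℝ) : Prop :=
  ∀ τ : Finset (Fin n), τ.card ≤ n - 2 →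
    ∃ g : Finset (Fin n) → ℝ, IsCoverageOn (Finset.univ \ τ) g ∧
      ∀ S ⊆ Finset.univ \ τ, S.Nonempty → S.card ≤ 2 → f (τ ∪ S) = g S + f τ

/-- Monotone set function. -/
def MonotoneSet {n : ℕ} (f : Finset (Fin n) → ℝ) : Prop :=
  ∀ ⦃A B : Finset (Fin n)⦄, A ⊆ B → f A ≤ f B

/-- Submodular set function (diminishing returns). -/
def SubmodularSet {n : ℕ} (f : Finset (Fin n) → ℝ) : Prop :=
  ∀ ⦃S T : Finset (Fin n)⦄, S ⊆ T → ∀ i : Fin n,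
    f (insert i T) - f T ≤ f (insert i S) - f S

/-- `levelSum f i = ∑_{|S| = i} f S`. -/
noncomputable def levelSum {n : ℕ} (f : Finset (Fin n) → ℝ) (i : ℕ) : ℝ :=
  ∑ S ∈ Finset.powersetCard i (Finset.univ : Finset (Fin n)), f S

/-- A matroid on ground set `Fin n`, given by its independent sets. -/
structure FinMatroid (n : ℕ) where
  Indep : Finset (Fin n) → Prop
  indep_empty : Indep ∅
  indep_subset : ∀ ⦃S T : Finset (Fin n)⦄, Indep T → S ⊆ T → Indep S
  indep_exchange : ∀ ⦃S T : Finset (Fin n)⦄, Indep S → Indep T → S.card < T.card →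
    ∃ i ∈ T, i ∉ S ∧ Indep (insert i S)

open Classical in
/-- The rank of `S`: the maximum cardinality of an independent subset of `S`. -/
noncomputable def FinMatroid.rank {n : ℕ} (M : FinMatroid n) (S : Finset (Fin n)) : ℕ :=
  (S.powerset.filter fun T => M.Indep T).sup Finset.card

/-- The polynomial `p = 3 x₁ x₂ + x₁ x₃ + x₂ x₃` (0-indexed variables over `Fin 3`). -/
noncomputable def pCounter : MvPolynomial (Fin 3) ℝ :=
  MvPolynomial.C 3 * (MvPolynomial.X 0 * MvPolynomial.X 1) +
    MvPolynomial.X 0 * MvPolynomial.X 2 + MvPolynomial.X 1 * MvPolynomial.X 2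

theorem eval_pCounter (x : Fin 3 → ℝ) :
    MvPolynomial.eval x pCounter = 3 * (x 0 * x 1) + x 0 * x 2 + x 1 * x 2 := by
  simp [pCounter]

theorem pCounter_multiaffine : ∀ m ∈ pCounter.support, ∀ i, m i ≤ 1 := by
  intro m hm i
  refine (MvPolynomial.monomial_le_degreeOf i hm).trans ?_
  have hmul (j k : Fin 3) (hjk : j ≠ k) :
      MvPolynomial.degreeOf i
        (MvPolynomial.X j * MvPolynomial.X k : MvPolynomial (Fin 3) ℝ) ≤ 1 := by
    refine (MvPolynomial.degreeOf_mul_le _ _ _).trans ?_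
    rw [MvPolynomial.degreeOf_X, MvPolynomial.degreeOf_X]
    split_ifs <;> simp_all
  refine (MvPolynomial.degreeOf_add_le _ _ _).trans (max_le ?_ (hmul 1 2 (by decide)))
  refine (MvPolynomial.degreeOf_add_le _ _ _).trans (max_le ?_ (hmul 0 2 (by decide)))
  exact (MvPolynomial.degreeOf_C_mul_le _ _ _).trans (hmul 0 1 (by decide))

theorem pCounter_isHomogeneous : pCounter.IsHomogeneous 2 := by
  have hmul (j k : Fin 3) :
      (MvPolynomial.X j * MvPolynomial.X k : MvPolynomial (Fin 3) ℝ).IsHomogeneous 2 :=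
    (MvPolynomial.isHomogeneous_X ℝ j).mul (MvPolynomial.isHomogeneous_X ℝ k)
  exact (((hmul 0 1).C_mul 3).add (hmul 0 2)).add (hmul 1 2)

/-- The reverse Cauchy–Schwarz inequality for the Lorentz form `a² - b² - c²`. -/
theorem reverse_cauchy_schwarz {a b c a' b' c' : ℝ} (ha' : a' ≠ 0)
    (h : b' ^ 2 + c' ^ 2 ≤ a' ^ 2) :
    (a ^ 2 - b ^ 2 - c ^ 2) * (a' ^ 2 - b' ^ 2 - c' ^ 2) ≤ (a * a' - b * b' - c * c') ^ 2 := by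
  have key : 0 ≤ a' ^ 2 * ((a * a' - b * b' - c * c') ^ 2 -
      (a ^ 2 - b ^ 2 - c ^ 2) * (a' ^ 2 - b' ^ 2 - c' ^ 2)) := by
    have h₁ := mul_le_mul_of_nonneg_right h
      (add_nonneg (sq_nonneg (a * b' - a' * b)) (sq_nonneg (a * c' - a' * c)))
    have h₂ := sq_nonneg (b' * (a * b' - a' * b) + c' * (a * c' - a' * c))
    linear_combination h₁ + h₂
  exact sub_nonneg.mp (nonneg_of_mul_nonneg_right key (by positivity))

/-- A quadratic form whose polarization dominates the geometric mean is log-concave. -/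
theorem rpow_mul_rpow_le_of_sq_le {p q B t : ℝ} (hp : 0 ≤ p) (hq : 0 ≤ q) (hB : 0 ≤ B)
    (hpq : p * q ≤ B ^ 2) (ht : 0 ≤ t) (ht' : t ≤ 1) :
    p ^ t * q ^ (1 - t) ≤ t ^ 2 * p + 2 * (t * (1 - t)) * B + (1 - t) ^ 2 * q := by
  have hs : 0 ≤ 1 - t := sub_nonneg.mpr ht'
  have hroot : √p * √q ≤ B := by
    rw [← Real.sqrt_mul hp]
    exact Real.sqrt_le_iff.mpr ⟨hB, hpq⟩
  have amgm := Real.geom_mean_le_arith_mean2_weighted ht hs (Real.sqrt_nonneg p)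
    (Real.sqrt_nonneg q) (add_sub_cancel t 1)
  have hsq : p ^ t * q ^ (1 - t) = (√p ^ t * √q ^ (1 - t)) ^ 2 := by
    rw [mul_pow, ← Real.rpow_mul_natCast (Real.sqrt_nonneg p),
      ← Real.rpow_mul_natCast (Real.sqrt_nonneg q), mul_comm t, mul_comm (1 - t),
      Real.rpow_natCast_mul (Real.sqrt_nonneg p), Real.rpow_natCast_mul (Real.sqrt_nonneg q),
      Real.sq_sqrt hp, Real.sq_sqrt hq]
  calc p ^ t * q ^ (1 - t) = (√p ^ t * √q ^ (1 - t)) ^ 2 := hsq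
    _ ≤ (t * √p + (1 - t) * √q) ^ 2 := by gcongr
    _ = t ^ 2 * √p ^ 2 + 2 * (t * (1 - t)) * (√p * √q) + (1 - t) ^ 2 * √q ^ 2 := by ring
    _ ≤ _ := by
      rw [Real.sq_sqrt hp, Real.sq_sqrt hq]
      gcongr

theorem pCounter_logConcaveOn : LogConcaveOn pCounter := by
  refine ⟨fun x hx => ?_, fun x y hx hy t ht ht' => ?_⟩
  · rw [eval_pCounter]
    have := hx 0; have := hx 1; have := hx 2
    positivity
  simp only [eval_pCounter]
  have hx0 := hx 0; have hx1 := hx 1; have hx2 := hx 2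
  have hy0 := hy 0; have hy1 := hy 1; have hy2 := hy 2
  generalize x 0 = x₀ at *; generalize x 1 = x₁ at *; generalize x 2 = x₂ at *
  generalize y 0 = y₀ at *; generalize y 1 = y₁ at *; generalize y 2 = y₂ at *
  have hpq : (3 * (x₀ * x₁) + x₀ * x₂ + x₁ * x₂) * (3 * (y₀ * y₁) + y₀ * y₂ + y₁ * y₂) ≤
      ((3 * (x₀ * y₁ + x₁ * y₀) + x₀ * y₂ + x₂ * y₀ + x₁ * y₂ + x₂ * y₁) / 2) ^ 2 := by
    rcases eq_or_ne (3 * (y₀ + y₁) + 2 * y₂) 0 with h | h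
    · obtain rfl : y₀ = 0 := by linarith
      obtain rfl : y₁ = 0 := by linarith
      obtain rfl : y₂ = 0 := by linarith
      simp
    · have := reverse_cauchy_schwarz (a := 3 * (x₀ + x₁) + 2 * x₂) (b := 3 * (x₀ - x₁))
        (c := 2 * x₂) (b' := 3 * (y₀ - y₁)) (c' := 2 * y₂) h (by
          have : 0 ≤ 36 * (y₀ * y₁) + 12 * (y₀ * y₂) + 12 * (y₁ * y₂) := by positivity
          linear_combination this)
      linear_combination this / 144
  refine (rpow_mul_rpow_le_of_sq_le (by positivity) (by positivity) (by positivity) hpq ht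
    ht').trans_eq ?_
  ring

theorem coeff_genPoly {n : ℕ} (f : Finset (Fin n) → ℝ) (S : Finset (Fin n)) :
    (genPoly f).coeff (∑ i ∈ S, Finsupp.single i 1) = f S := by
  have hinj (T : Finset (Fin n))
      (h : ∑ i ∈ T, Finsupp.single i 1 = ∑ i ∈ S, Finsupp.single i (1 : ℕ)) : T = S := by
    ext j
    have := DFunLike.congr_fun h j
    simp only [Finsupp.finsetSum_apply, Finsupp.single_apply, Finset.sum_ite_eq'] at this
    by_cases hT : j ∈ T <;> by_cases hS : j ∈ S <;> simp_all
  have hmon (T : Finset (Fin n)) :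
      ∏ i ∈ T, (MvPolynomial.X i : MvPolynomial (Fin n) ℝ) =
        MvPolynomial.monomial (∑ i ∈ T, Finsupp.single i 1) 1 := by
    simp [MvPolynomial.monomial_sum_one, MvPolynomial.X]
  simp only [genPoly, MvPolynomial.coeff_sum, MvPolynomial.coeff_C_mul, hmon,
    MvPolynomial.coeff_monomial]
  rw [Finset.sum_eq_single S]
  · simp
  · intro T _ hT
    rw [if_neg fun h => hT (hinj T h), mul_zero]
  · simp

theorem card_le_totalDegree_genPoly {n : ℕ} {f : Finset (Fin n) → ℝ} {S : Finset (Fin n)}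
    (hS : f S ≠ 0) : S.card ≤ (genPoly f).totalDegree := by
  have h := MvPolynomial.le_totalDegree
    (MvPolynomial.mem_support_iff.mpr ((coeff_genPoly f S).trans_ne hS))
  rw [Finsupp.sum_fintype _ _ (fun _ => rfl)] at h
  simpa [Finsupp.finsetSum_apply, Finsupp.single_apply] using h

/-- Coverage functions satisfy `g (S ∪ T) + g (S ∩ T) ≤ g S + g T`. -/
theorem IsCoverageOn.union_add_inter_le {n : ℕ} {V : Finset (Fin n)} {g : Finset (Fin n) → ℝ}
    (hg : IsCoverageOn V g) {S T : Finset (Fin n)} (hS : S ⊆ V) (hT : T ⊆ V) :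
    g (S ∪ T) + g (S ∩ T) ≤ g S + g T := by
  obtain ⟨m, w, A, hw, hgA⟩ := hg
  rw [hgA _ (Finset.union_subset hS hT), hgA _ (Finset.inter_subset_left.trans hS), hgA _ hS,
    hgA _ hT, Finset.union_biUnion, ← Finset.sum_union_inter (s₁ := S.biUnion A)]
  gcongr
  · exact fun u _ _ => hw u
  · exact Finset.subset_inter
      (Finset.biUnion_subset_biUnion_of_subset_left A Finset.inter_subset_left)
      (Finset.biUnion_subset_biUnion_of_subset_left A Finset.inter_subset_right)

theorem IsCoverageOn.mono {n : ℕ} {V : Finset (Fin n)} {g : Finset (Fin n) → ℝ}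
    (hg : IsCoverageOn V g) {S T : Finset (Fin n)} (hST : S ⊆ T) (hT : T ⊆ V) : g S ≤ g T := by
  obtain ⟨m, w, A, hw, hgA⟩ := hg
  rw [hgA _ (hST.trans hT), hgA _ hT]
  exact Finset.sum_le_sum_of_subset_of_nonneg
    (Finset.biUnion_subset_biUnion_of_subset_left A hST) fun u _ _ => hw u

theorem not_twoCoverageWrt_two {f : Finset (Fin 3) → ℝ} (h01 : f {0, 1} = 3)
    (h02 : f {0, 2} = 1) (h12 : f {1, 2} = 1) : ¬ TwoCoverageWrt f 2 := by
  rintro ⟨-, h⟩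
  obtain ⟨V, -, g, l, hg, hl, hlg, hf⟩ := h ∅ rfl
  have pair (i j : Fin 3) (hij : i ≠ j) (hfij : f {i, j} ≠ 0) :
      {i, j} ⊆ V ∧ f {i, j} = g {i, j} - (l {i} + l {j}) / 2 := by
    have h := hf {i, j} (by simp) (Finset.card_pair hij)
    rw [Finset.empty_union] at h
    split_ifs at h with hV
    · rw [hl.2 _ hV, Finset.sum_pair hij] at h
      exact ⟨hV, h⟩
    · exact absurd h hfij
  obtain ⟨hV01, e01⟩ := pair 0 1 (by decide) (by simp [h01])
  obtain ⟨hV02, e02⟩ := pair 0 2 (by decide) (by simp [h02])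
  obtain ⟨hV12, e12⟩ := pair 1 2 (by decide) (by simp [h12])
  have hsub := hg.union_add_inter_le hV02 hV12
  have hmono := hg.mono (show {0, 1} ⊆ ({0, 2} ∪ {1, 2} : Finset (Fin 3)) by decide)
    (Finset.union_subset hV02 hV12)
  rw [show ({0, 2} ∩ {1, 2} : Finset (Fin 3)) = {2} by decide] at hsub
  have := hlg 2 (hV02 (by decide))
  linarith

theorem not_monotone_submodular {f : Finset (Fin 3) → ℝ} (hf : 0 ≤ f {2}) (h01 : f {0, 1} = 3)
    (h02 : f {0, 2} = 1) (h12 : f {1, 2} = 1) (hmono : MonotoneSet f) : ¬ SubmodularSet f := by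
  intro hsub
  have h₁ := hsub (show {2} ⊆ ({1, 2} : Finset (Fin 3)) by decide) 0
  have h₂ := hmono (show {0, 1} ⊆ (insert 0 {1, 2} : Finset (Fin 3)) by decide)
  linarith

/-- (a) `pCounter` is a 2-homogeneous multiaffine log-concave polynomial;
(b) any nonnegative set function `f` on `[3]` with `f {1,2} = 3`, `f {1,3} = 1`,
`f {2,3} = 1` is neither simultaneously monotone, submodular and nonnegative on
nonempty sets, nor a 2-coverage function. -/
theorem stmt_18 :
    ((∀ m ∈ pCounter.support, ∀ i, m i ≤ 1) ∧ pCounter.IsHomogeneous 2 ∧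
        LogConcaveOn pCounter) ∧
      ∀ f : Finset (Fin 3) → ℝ, (∀ S, 0 ≤ f S) →
        f {0, 1} = 3 → f {0, 2} = 1 → f {1, 2} = 1 →
        (¬ (MonotoneSet f ∧ SubmodularSet f ∧
            ∀ S : Finset (Fin 3), S.Nonempty → 0 ≤ f S)) ∧
          ¬ (∀ d : ℕ, 2 ≤ d → d ≤ (genPoly f).totalDegree → TwoCoverageWrt f d) := by
  refine ⟨⟨pCounter_multiaffine, pCounter_isHomogeneous, pCounter_logConcaveOn⟩,
    fun f hf h01 h02 h12 => ⟨?_, fun h => ?_⟩⟩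
  · rintro ⟨hmono, hsub, -⟩
    exact not_monotone_submodular (hf _) h01 h02 h12 hmono hsub
  · have hdeg : 2 ≤ (genPoly f).totalDegree :=
      card_le_totalDegree_genPoly (f := f) (S := {0, 1}) (by simp [h01])
    exact not_twoCoverageWrt_two h01 h02 h12 (h 2 le_rfl hdeg)
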